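/- The weight distribution of C_O^36 is: the number of codewords of Hamming weight w equals 1 for w=0, 444 for w=8, 496 for w=9, 2160 for w=10, 4752 for w=11, 8760 for w=12, 17856 for w=13, 28992 for w=14, 44352 for w=15, 54318 for w=16, 62496 for w=17, 72864 for w=18, 66528 for w=19, 54192 for w=20, 41664 for w=21, 28992 for w=22, 19008 for w=23, 8844 for w=24, 4464 for w=25, 2160 for w=26, 528 for w=27, 408 for w=28, 9 for w=32, and 0 for all other w. -/

import Mathlib

open Matrix
open scoped Classical

noncomputable section

abbrev F4 := GaloisField 2 2
abbrev F2 := ZMod 2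

/-- Hamming weight: number of nonzero coordinates. -/
def wt {n : ℕ} {α : Type*} [Zero α] (v : Fin n → α) : ℕ :=
  Nat.card {i : Fin n // v i ≠ 0}

def r1 (ω : F4) : Fin 9 → F4 := ![1, 0, 0, 0, 0, ω + 1, 1, 1, 1]
def r2 (ω : F4) : Fin 9 → F4 := ![ω, 0, 0, 0, 0, 1, ω, ω, ω]
def r3 (ω : F4) : Fin 9 → F4 := ![0, 1, 0, 0, 0, 1, ω, ω + 1, 0]
def r4 (ω : F4) : Fin 9 → F4 := ![0, ω, 0, 0, 0, ω, ω + 1, 1, 0]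
def r5 (ω : F4) : Fin 9 → F4 := ![0, 0, 1, 0, 0, 0, 1, ω, ω + 1]
def r6 (ω : F4) : Fin 9 → F4 := ![0, 0, ω, 0, 0, 0, ω, ω + 1, 1]
def r7 (ω : F4) : Fin 9 → F4 := ![0, 0, 0, 1, 0, ω + 1, ω + 1, 0, 1]
def r8 (ω : F4) : Fin 9 → F4 := ![0, 0, 0, ω, 0, 1, 1, 0, ω]
def r9 (ω : F4) : Fin 9 → F4 := ![0, 0, 0, 0, 1, 1, ω, 1, 1]
def r10 (ω : F4) : Fin 9 → F4 := ![0, 0, 0, 0, ω, ω, ω + 1, ω, ω]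

/-- φ : GF(4) → GF(2)⁴ with φ(0)=0000, φ(1)=0011, φ(ω)=0101, φ(ω̄)=0110. -/
def phi (ω : F4) (x : F4) : Fin 4 → F2 :=
  if x = 0 then ![0, 0, 0, 0]
  else if x = 1 then ![0, 0, 1, 1]
  else if x = ω then ![0, 1, 0, 1]
  else ![0, 1, 1, 0]

/-- Φ applies φ to each coordinate and concatenates. -/
def Phi (ω : F4) (v : Fin 9 → F4) : Fin 36 → F2 := fun j =>
  phi ω (v ⟨j.val / 4, by have := j.isLt; omega⟩) ⟨j.val % 4, by omega⟩

/-- u i (for i = 0, …, 7, corresponding to u_(i+1)) has ones exactly in the eight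
positions 4(i+1)-3, …, 4(i+1)+4 (1-indexed). -/
def u (i : Fin 8) : Fin 36 → F2 := fun j =>
  if 4 * i.val ≤ j.val ∧ j.val < 4 * i.val + 8 then 1 else 0

/-- (1,0,0,0) repeated 9 times. -/
def d1 : Fin 36 → F2 := fun j => if j.val % 4 = 0 then 1 else 0

/-- (1,0,0,0) repeated 8 times followed by (0,1,1,1). -/
def d2 : Fin 36 → F2 := fun j =>
  if j.val < 32 then (if j.val % 4 = 0 then 1 else 0)
  else (if j.val % 4 = 0 then 0 else 1)

def gensO36 (ω : F4) : Fin 19 → Fin 36 → F2 :=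
  ![Phi ω (r1 ω), Phi ω (r2 ω), Phi ω (r3 ω), Phi ω (r4 ω), Phi ω (r5 ω),
    Phi ω (r6 ω), Phi ω (r7 ω), Phi ω (r8 ω), Phi ω (r9 ω), Phi ω (r10 ω),
    u 0, u 1, u 2, u 3, u 4, u 5, u 6, u 7, d1]

def CO36 (ω : F4) : Submodule F2 (Fin 36 → F2) :=
  Submodule.span F2 (Set.range (gensO36 ω))

/-- The generators of `C_4^9` in coordinates with respect to the basis `1, ω`. -/
def quatGens : Fin 10 → Fin 9 → F2 × F2 :=
  ![![(1,0), (0,0), (0,0), (0,0), (0,0), (1,1), (1,0), (1,0), (1,0)],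
    ![(0,1), (0,0), (0,0), (0,0), (0,0), (1,0), (0,1), (0,1), (0,1)],
    ![(0,0), (1,0), (0,0), (0,0), (0,0), (1,0), (0,1), (1,1), (0,0)],
    ![(0,0), (0,1), (0,0), (0,0), (0,0), (0,1), (1,1), (1,0), (0,0)],
    ![(0,0), (0,0), (1,0), (0,0), (0,0), (0,0), (1,0), (0,1), (1,1)],
    ![(0,0), (0,0), (0,1), (0,0), (0,0), (0,0), (0,1), (1,1), (1,0)],
    ![(0,0), (0,0), (0,0), (1,0), (0,0), (1,1), (1,1), (0,0), (1,0)],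
    ![(0,0), (0,0), (0,0), (0,1), (0,0), (1,0), (1,0), (0,0), (0,1)],
    ![(0,0), (0,0), (0,0), (0,0), (1,0), (1,0), (0,1), (1,0), (1,0)],
    ![(0,0), (0,0), (0,0), (0,0), (0,1), (0,1), (1,1), (0,1), (0,1)]]

/-- The word of `C_4^9` with message `a`, in coordinates with respect to `1, ω`. -/
def quatWord (a : Fin 10 → F2) (i : Fin 9) : F2 × F2 := ∑ k, a k • quatGens k i

/-- The block `φ(x) + s • 1111 + e • 1000`, where `x` stands for `x.1 + x.2 ω`. -/
def block (x : F2 × F2) (s e : F2) : Fin 4 → F2 :=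
  ![s + e, x.2 + s, x.1 + s, x.1 + x.2 + s]

/-- The concatenation of the nine blocks `block (x i) (s i) e`. -/
def blocks (x : Fin 9 → F2 × F2) (s : Fin 9 → F2) (e : F2) (j : Fin 36) : F2 :=
  block (x ⟨j.val / 4, by omega⟩) (s ⟨j.val / 4, by omega⟩) e ⟨j.val % 4, by omega⟩

/-- The element of `GF(4)` with the given coordinates with respect to `1, ω`. -/
def ofCoords (ω : F4) (x : F2 × F2) : F4 := x.1 • (1 : F4) + x.2 • ω

lemma f2_eq_zero_or_one : ∀ p : F2, p = 0 ∨ p = 1 := by decide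

lemma phi_ofCoords {ω : F4} (hω : ω ^ 2 = ω + 1) (x : F2 × F2) :
    phi ω (ofCoords ω x) = block x 0 0 := by
  have h0 : ω ≠ 0 := by rintro rfl; simp at hω
  have h1 : ω ≠ 1 := by rintro rfl; simp at hω
  have h2 : 1 + ω ≠ 0 := fun h => h1 (CharTwo.add_eq_zero.1 h).symm
  obtain ⟨p, q⟩ := x
  rcases f2_eq_zero_or_one p with rfl | rfl <;> rcases f2_eq_zero_or_one q with rfl | rfl <;>
    simp [ofCoords, phi, block, h0, h1, h2, CharTwo.add_self_eq_zero]

lemma Phi_eq_blocks {ω : F4} (hω : ω ^ 2 = ω + 1) {v : Fin 9 → F4} {x : Fin 9 → F2 × F2}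
    (hv : ∀ i, v i = ofCoords ω (x i)) : Phi ω v = blocks x 0 0 := by
  ext j
  simp [Phi, blocks, hv, phi_ofCoords hω]

/-- The repetition pattern of the combination of the `u i` with coefficients `t`. -/
def pattern (t : Fin 8 → F2) : Fin 9 → F2 :=
  ![t 0, t 0 + t 1, t 1 + t 2, t 2 + t 3, t 3 + t 4, t 4 + t 5, t 5 + t 6, t 6 + t 7, t 7]

lemma gensO36_castAdd {ω : F4} (hω : ω ^ 2 = ω + 1) (k : Fin 10) :
    gensO36 ω (Fin.castAdd 9 k) = blocks (quatGens k) 0 0 := by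
  fin_cases k <;> refine Phi_eq_blocks hω fun i => ?_ <;> fin_cases i <;>
    simp [r1, r2, r3, r4, r5, r6, r7, r8, r9, r10, quatGens, ofCoords, add_comm]

lemma sum_smul_quatGens (a : Fin 10 → F2) :
    ∑ k, a k • blocks (quatGens k) 0 0 = blocks (quatWord a) 0 0 := by
  ext j
  simp only [blocks, quatWord, Finset.sum_apply, Pi.smul_apply]
  generalize (⟨j.val % 4, by omega⟩ : Fin 4) = r
  fin_cases r <;>
    simp [block, Prod.fst_sum, Prod.snd_sum, mul_add, Finset.sum_add_distrib]

lemma sum_smul_u (t : Fin 8 → F2) : ∑ i, t i • u i = blocks 0 (pattern t) 0 := by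
  ext j
  simp only [Finset.sum_apply, Pi.smul_apply]
  fin_cases j <;> simp [Fin.sum_univ_succ, u, blocks, pattern, block]

lemma smul_d1 (e : F2) : e • d1 = blocks 0 0 e := by
  ext j
  fin_cases j <;> simp [d1, blocks, block]

lemma blocks_eq_add (x : Fin 9 → F2 × F2) (s : Fin 9 → F2) (e : F2) :
    blocks x s e = blocks x 0 0 + (blocks 0 s 0 + blocks 0 0 e) := by
  ext j
  simp only [blocks, Pi.add_apply]
  generalize (⟨j.val % 4, by omega⟩ : Fin 4) = r
  fin_cases r <;> simp [block]

lemma sum_smul_gensO36 {ω : F4} (hω : ω ^ 2 = ω + 1) (c : Fin 19 → F2) :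
    ∑ k, c k • gensO36 ω k =
      blocks (quatWord fun k => c (Fin.castAdd 9 k))
        (pattern fun i => c (Fin.natAdd 10 i.castSucc)) (c (Fin.last 18)) := by
  have hu : ∀ i : Fin 8, gensO36 ω (Fin.natAdd 10 i.castSucc) = u i := by
    intro i
    fin_cases i <;> rfl
  rw [blocks_eq_add, ← sum_smul_quatGens, ← sum_smul_u, ← smul_d1,
    Fin.sum_univ_add (a := 10) (b := 9), Fin.sum_univ_castSucc (n := 8)]
  simp only [gensO36_castAdd hω, hu]
  rfl

lemma exists_pattern_eq {s : Fin 9 → F2} : (∃ t, pattern t = s) ↔ ∑ i, s i = 0 := by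
  constructor
  · rintro ⟨t, rfl⟩
    simp [pattern, Fin.sum_univ_succ]
    grind
  · intro h
    refine ⟨![s 0, s 0 + s 1, s 0 + s 1 + s 2, s 0 + s 1 + s 2 + s 3, s 0 + s 1 + s 2 + s 3 + s 4,
      s 0 + s 1 + s 2 + s 3 + s 4 + s 5, s 0 + s 1 + s 2 + s 3 + s 4 + s 5 + s 6,
      s 0 + s 1 + s 2 + s 3 + s 4 + s 5 + s 6 + s 7], ?_⟩
    simp only [Fin.sum_univ_succ] at h
    ext i
    fin_cases i <;> simp [pattern] at h ⊢ <;> grind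

lemma block_injective : ∀ x s e y t f, block x s e = block y t f → x = y ∧ s = t ∧ e = f := by
  decide

lemma quatWord_injective : Function.Injective quatWord := by
  intro a b h
  ext k
  have h0 := congrFun h 0
  have h1 := congrFun h 1
  have h2 := congrFun h 2
  have h3 := congrFun h 3
  have h4 := congrFun h 4
  simp [quatWord, quatGens, Fin.sum_univ_succ, Prod.ext_iff] at h0 h1 h2 h3 h4
  fin_cases k <;> simp [*] 

lemma sum_blocks_eq (f : F2 → ℕ) (x : Fin 9 → F2 × F2) (s : Fin 9 → F2) (e : F2) :
    ∑ j, f (blocks x s e j) = ∑ i, ∑ r, f (block (x i) (s i) e r) := by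
  rw [← finProdFinEquiv.sum_comp (fun j : Fin (9 * 4) => f (blocks x s e j)), Fintype.sum_prod_type]
  refine Finset.sum_congr rfl fun i _ => Finset.sum_congr rfl fun r _ => ?_
  have h1 : (r.val + 4 * i.val) / 4 = i := by omega
  have h2 : (r.val + 4 * i.val) % 4 = r := by omega
  simp [blocks, finProdFinEquiv, h1, h2]

lemma mem_CO36_iff {ω : F4} (hω : ω ^ 2 = ω + 1) (v : Fin 36 → F2) :
    v ∈ CO36 ω ↔ ∃ a s e, ∑ i, s i = 0 ∧ blocks (quatWord a) s e = v := by
  rw [CO36, Submodule.mem_span_range_iff_exists_fun]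
  constructor
  · rintro ⟨c, rfl⟩
    exact ⟨_, _, _, exists_pattern_eq.1 ⟨_, rfl⟩, (sum_smul_gensO36 hω c).symm⟩
  · rintro ⟨a, s, e, hs, rfl⟩
    obtain ⟨t, rfl⟩ := exists_pattern_eq.2 hs
    refine ⟨Fin.append a (Fin.snoc t e : Fin 9 → F2), ?_⟩
    rw [sum_smul_gensO36 hω]
    congr 2
    · simp
    · simp

lemma blocks_quatWord_injective :
    Function.Injective fun c : (Fin 10 → F2) × (Fin 9 → F2) × F2 =>
      blocks (quatWord c.1) c.2.1 c.2.2 := by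
  rintro ⟨a, s, e⟩ ⟨b, t, f⟩ h
  have hb : ∀ i, block (quatWord a i) (s i) e = block (quatWord b i) (t i) f := by
    intro i
    ext r
    have h1 : (4 * i.val + r.val) / 4 = i := by omega
    have h2 : (4 * i.val + r.val) % 4 = r := by omega
    simpa [blocks, h1, h2] using congrFun h ⟨4 * i.val + r.val, by omega⟩
  simp only [Prod.mk.injEq]
  exact ⟨quatWord_injective (funext fun i => (block_injective _ _ _ _ _ _ (hb i)).1),
    funext fun i => (block_injective _ _ _ _ _ _ (hb i)).2.1,
    (block_injective _ _ _ _ _ _ (hb 0)).2.2⟩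

open Polynomial

lemma two_mul_sum_filter_even_prod {n : ℕ} {R : Type*} [CommRing R] (f : Fin n → F2 → R) :
    2 * ∑ s : Fin n → F2 with ∑ i, s i = 0, ∏ i, f i (s i) =
      ∏ i, (f i 0 + f i 1) + ∏ i, (f i 0 - f i 1) := by
  let χ : AddChar F2 R :=
    { toFun := fun s => if s = 0 then 1 else -1
      map_zero_eq_one' := by simp
      map_add_eq_mul' := fun s t => by
        rcases f2_eq_zero_or_one s with rfl | rfl <;> rcases f2_eq_zero_or_one t with rfl | rfl <;>
          simp [CharTwo.add_self_eq_zero] }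
  have hχ : ∀ s, χ s = if s = 0 then 1 else -1 := fun _ => rfl
  have hF2 : ∀ g : F2 → R, ∑ s, g s = g 0 + g 1 := fun g => Fin.sum_univ_two g
  have hsum : ∀ s : Fin n → F2, χ (∑ i, s i) = ∏ i, χ (s i) := fun s =>
    map_prod χ.toMonoidHom (fun i => Multiplicative.ofAdd (s i)) Finset.univ
  have h1 : ∏ i, (f i 0 + f i 1) = ∑ s : Fin n → F2, ∏ i, f i (s i) := by
    rw [← Fintype.piFinset_univ, ← Finset.prod_univ_sum]
    exact Finset.prod_congr rfl fun i _ => (hF2 _).symm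
  have h2 : ∏ i, (f i 0 - f i 1) = ∑ s : Fin n → F2, ∏ i, χ (s i) * f i (s i) := by
    rw [← Fintype.piFinset_univ, ← Finset.prod_univ_sum (f := fun i s => χ s * f i s)]
    refine Finset.prod_congr rfl fun i _ => ?_
    rw [hF2, hχ, hχ, if_pos rfl, if_neg one_ne_zero]
    ring
  rw [h1, h2, ← Finset.sum_add_distrib, Finset.mul_sum, Finset.sum_filter]
  refine Finset.sum_congr rfl fun s _ => ?_
  rw [Finset.prod_mul_distrib, ← hsum]
  split_ifs with h <;> simp [hχ, h, two_mul]

lemma coeff_sum_X_pow {ι : Type*} (S : Finset ι) (f : ι → ℕ) (w : ℕ) :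
    (∑ c ∈ S, (X : ℤ[X]) ^ f c).coeff w = (S.filter fun c => f c = w).card := by
  simp only [finsetSum_coeff, coeff_X_pow, Finset.sum_boole, eq_comm]

/-- The number of nonzero coordinates of the word of `C_4^9` with message `a`. -/
def quatWt (a : Fin 10 → F2) : ℕ := (Finset.univ.filter fun i => quatWord a i ≠ 0).card

lemma quatWord_eq (a : Fin 10 → F2) : quatWord a =
  ![(a 0, a 1),
    (a 2, a 3),
    (a 4, a 5),
    (a 6, a 7),
    (a 8, a 9),
    (a 0 + a 1 + a 2 + a 6 + a 7 + a 8, a 0 + a 3 + a 6 + a 9),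
    (a 0 + a 3 + a 4 + a 6 + a 7 + a 9, a 1 + a 2 + a 3 + a 5 + a 6 + a 8 + a 9),
    (a 0 + a 2 + a 3 + a 5 + a 8, a 1 + a 2 + a 4 + a 5 + a 9),
    (a 0 + a 4 + a 5 + a 6 + a 8, a 1 + a 4 + a 7 + a 9)] := by
  ext i <;> fin_cases i <;> simp [quatWord, quatGens, Fin.sum_univ_succ] <;> ring

/-- The weight, `0` or `1`, of the class of `(p, q)` in `F2 × F2`, seen as one symbol. -/
def pairWt (p q : ℕ) : ℕ := if p % 2 = 0 ∧ q % 2 = 0 then 0 else 1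

/-- `quatWt`, computed with natural numbers, which is fast in the kernel. -/
def natWt (a : Fin 10 → ℕ) : ℕ :=
  pairWt (a 0) (a 1) + pairWt (a 2) (a 3) + pairWt (a 4) (a 5) + pairWt (a 6) (a 7) +
    pairWt (a 8) (a 9) +
    pairWt (a 0 + a 1 + a 2 + a 6 + a 7 + a 8) (a 0 + a 3 + a 6 + a 9) +
    pairWt (a 0 + a 3 + a 4 + a 6 + a 7 + a 9) (a 1 + a 2 + a 3 + a 5 + a 6 + a 8 + a 9) +
    pairWt (a 0 + a 2 + a 3 + a 5 + a 8) (a 1 + a 2 + a 4 + a 5 + a 9) +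
    pairWt (a 0 + a 4 + a 5 + a 6 + a 8) (a 1 + a 4 + a 7 + a 9)

lemma quatWt_eq (a : Fin 10 → F2) : quatWt a = natWt fun k => (a k).val := by
  have h : ∀ (x : F2 × F2) [Decidable (x ≠ 0)],
      (if x ≠ 0 then 1 else 0) = pairWt x.1.val x.2.val := by
    intro x _
    have h' : ∀ y : F2 × F2, y ≠ 0 ↔ ¬ (y.1.val % 2 = 0 ∧ y.2.val % 2 = 0) := by decide
    simp only [pairWt, h', ite_not]
  have hm : ∀ p q, pairWt (p % 2) (q % 2) = pairWt p q := by simp [pairWt]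
  rw [quatWt, quatWord_eq, Finset.card_filter]
  simp only [h, Fin.sum_univ_succ]
  simp [natWt, ZMod.val_add, hm, add_assoc]

set_option maxRecDepth 100000 in
lemma card_natWt_eq : ∀ k : Fin 10,
    (Finset.univ.filter fun a : Fin 10 → F2 => natWt (fun k => (a k).val) = k).card =
      ![1, 0, 0, 0, 51, 135, 210, 318, 234, 75] k := by
  decide +kernel

lemma card_quatWt_eq (k : Fin 10) : (Finset.univ.filter fun a => quatWt a = k).card =
    ![1, 0, 0, 0, 51, 135, 210, 318, 234, 75] k := by
  rw [← card_natWt_eq]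
  exact congrArg Finset.card (Finset.filter_congr fun a _ => by rw [quatWt_eq])

lemma quatWt_le (a : Fin 10 → F2) : quatWt a ≤ 9 :=
  (Finset.card_le_univ _).trans_eq (Fintype.card_fin 9)

lemma sum_comp_quatWt {R : Type*} [Semiring R] (g : ℕ → R) :
    ∑ a, g (quatWt a) =
      g 0 + 51 * g 4 + 135 * g 5 + 210 * g 6 + 318 * g 7 + 234 * g 8 + 75 * g 9 := by
  have h := Finset.sum_fiberwise_of_maps_to (s := Finset.univ) (t := Finset.univ)
    (g := fun a => (⟨quatWt a, Nat.lt_succ_of_le (quatWt_le a)⟩ : Fin 10))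
    (fun _ _ => Finset.mem_univ _) (fun a => g (quatWt a))
  rw [← h]
  have h' : ∀ k : Fin 10, (∑ a with (⟨quatWt a, Nat.lt_succ_of_le (quatWt_le a)⟩ : Fin 10) = k,
      g (quatWt a)) = (![1, 0, 0, 0, 51, 135, 210, 318, 234, 75] k : ℕ) * g k := by
    intro k
    simp only [Fin.ext_iff]
    rw [← card_quatWt_eq, ← nsmul_eq_mul, ← Finset.sum_const]
    exact Finset.sum_congr rfl fun a ha => by rw [(Finset.mem_filter.1 ha).2]
  simp only [h', Fin.sum_univ_succ]
  simp [add_assoc]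

lemma prod_ite_quatWord {R : Type*} [CommMonoid R] (a : Fin 10 → F2) (p q : R) :
    ∏ i, (if quatWord a i = 0 then q else p) = q ^ (9 - quatWt a) * p ^ quatWt a := by
  have h := Finset.card_filter_add_card_filter_not (s := (Finset.univ : Finset (Fin 9)))
    (fun i => quatWord a i = 0)
  have h' : (Finset.univ.filter fun i => ¬ quatWord a i = 0).card = quatWt a :=
    congrArg Finset.card (Finset.filter_congr fun _ _ => Iff.rfl)
  rw [h', Finset.card_univ, Fintype.card_fin] at h
  rw [Finset.prod_ite, Finset.prod_const, Finset.prod_const, h', Nat.eq_sub_of_add_eq h]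

/-- The Hamming weight of `block x s e`. -/
def blockWt (x : F2 × F2) (s e : F2) : ℕ := ∑ r, if block x s e r = 0 then 0 else 1

lemma blockWt_zero : ∀ x s,
    blockWt x s 0 = if x = 0 then (if s = 0 then 0 else 4) else 2 := by
  decide

lemma blockWt_one : ∀ x s, blockWt x s 1 = if (x = 0 ↔ s = 0) then 1 else 3 := by
  decide

lemma wt_blocks (x : Fin 9 → F2 × F2) (s : Fin 9 → F2) (e : F2) :
    wt (blocks x s e) = ∑ i, blockWt (x i) (s i) e := by
  rw [wt, Nat.card_eq_fintype_card, Fintype.card_subtype, Finset.card_filter]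
  simp only [ne_eq, ite_not]
  exact sum_blocks_eq (fun y => if y = 0 then 0 else 1) x s e

lemma two_mul_sum_pow_wt_zero {R : Type*} [CommRing R] (x : R) (a : Fin 10 → F2) :
    2 * ∑ s : Fin 9 → F2 with ∑ i, s i = 0, x ^ wt (blocks (quatWord a) s 0) =
      (1 + x ^ 4) ^ (9 - quatWt a) * (2 * x ^ 2) ^ quatWt a +
        (1 - x ^ 4) ^ (9 - quatWt a) * 0 ^ quatWt a := by
  simp only [wt_blocks, ← Finset.prod_pow_eq_pow_sum]
  rw [two_mul_sum_filter_even_prod fun i s => x ^ blockWt (quatWord a i) s 0,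
    ← prod_ite_quatWord, ← prod_ite_quatWord]
  refine congrArg₂ _ ?_ ?_ <;> refine Finset.prod_congr rfl fun i _ => ?_ <;>
    by_cases h : quatWord a i = 0 <;> simp [blockWt_zero, h, two_mul]

lemma two_mul_sum_pow_wt_one {R : Type*} [CommRing R] (x : R) (a : Fin 10 → F2) :
    2 * ∑ s : Fin 9 → F2 with ∑ i, s i = 0, x ^ wt (blocks (quatWord a) s 1) =
      (x + x ^ 3) ^ 9 + (x - x ^ 3) ^ (9 - quatWt a) * (x ^ 3 - x) ^ quatWt a := by
  simp only [wt_blocks, ← Finset.prod_pow_eq_pow_sum]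
  rw [two_mul_sum_filter_even_prod fun i s => x ^ blockWt (quatWord a i) s 1,
    ← prod_ite_quatWord]
  refine congrArg₂ _ ?_ ?_
  · rw [← Fin.prod_const]
    refine Finset.prod_congr rfl fun i _ => ?_
    by_cases h : quatWord a i = 0 <;> simp [blockWt_one, h, add_comm]
  · refine Finset.prod_congr rfl fun i _ => ?_
    by_cases h : quatWord a i = 0 <;> simp [blockWt_one, h]

/-- The triples `(a, s, e)` parametrizing `C_O^36`. -/
def messages : Finset ((Fin 10 → F2) × (Fin 9 → F2) × F2) :=
  Finset.univ ×ˢ (Finset.univ.filter fun s => ∑ i, s i = 0) ×ˢ Finset.univ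

lemma ncard_wt_eq {ω : F4} (hω : ω ^ 2 = ω + 1) (w : ℕ) :
    {v | v ∈ CO36 ω ∧ wt v = w}.ncard =
      (messages.filter fun c => wt (blocks (quatWord c.1) c.2.1 c.2.2) = w).card := by
  rw [← Set.ncard_coe_finset, ← Set.ncard_image_of_injective _ blocks_quatWord_injective]
  congr 1
  ext v
  simp only [mem_CO36_iff hω, messages, Set.mem_ofPred_eq, Set.mem_image, Finset.coe_filter,
    Finset.mem_product, Finset.mem_filter, Finset.mem_univ, true_and, and_true, Prod.exists]
  constructor
  · rintro ⟨⟨a, s, e, hs, rfl⟩, h⟩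
    exact ⟨a, s, e, ⟨hs, h⟩, rfl⟩
  · rintro ⟨a, s, e, ⟨hs, h⟩, rfl⟩
    exact ⟨⟨a, s, e, hs, rfl⟩, h⟩

/-- The weight enumerator of `C_O^36`, evaluated at `x`. -/
def weightEnumerator {R : Type*} [CommRing R] (x : R) : R :=
  1 + 444 * x ^ 8 + 496 * x ^ 9 + 2160 * x ^ 10 + 4752 * x ^ 11 + 8760 * x ^ 12 +
    17856 * x ^ 13 + 28992 * x ^ 14 + 44352 * x ^ 15 + 54318 * x ^ 16 + 62496 * x ^ 17 +
    72864 * x ^ 18 + 66528 * x ^ 19 + 54192 * x ^ 20 + 41664 * x ^ 21 + 28992 * x ^ 22 +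
    19008 * x ^ 23 + 8844 * x ^ 24 + 4464 * x ^ 25 + 2160 * x ^ 26 + 528 * x ^ 27 +
    408 * x ^ 28 + 9 * x ^ 32

lemma two_mul_sum_messages_pow_wt {R : Type*} [CommRing R] (x : R) :
    2 * ∑ c ∈ messages, x ^ wt (blocks (quatWord c.1) c.2.1 c.2.2) =
      2 * weightEnumerator x := by
  have hF2 : ∀ g : F2 → R, ∑ e, g e = g 0 + g 1 := fun g => Fin.sum_univ_two g
  simp only [messages, Finset.sum_product, hF2, Finset.sum_add_distrib, mul_add]
  rw [Finset.mul_sum, Finset.mul_sum]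
  simp only [two_mul_sum_pow_wt_zero, two_mul_sum_pow_wt_one]
  rw [sum_comp_quatWt fun k => (1 + x ^ 4) ^ (9 - k) * (2 * x ^ 2) ^ k +
      (1 - x ^ 4) ^ (9 - k) * 0 ^ k,
    sum_comp_quatWt fun k => (x + x ^ 3) ^ 9 + (x - x ^ 3) ^ (9 - k) * (x ^ 3 - x) ^ k]
  norm_num [weightEnumerator]
  ring

lemma sum_messages_pow_wt {R : Type*} [CommRing R] [IsDomain R] [CharZero R] (x : R) :
    ∑ c ∈ messages, x ^ wt (blocks (quatWord c.1) c.2.1 c.2.2) = weightEnumerator x :=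
  mul_left_cancel₀ two_ne_zero (two_mul_sum_messages_pow_wt x)

theorem stmt14 (ω : F4) (hω : ω ^ 2 = ω + 1) (w : ℕ) :
    Set.ncard {v | v ∈ CO36 ω ∧ wt v = w} =
      if w = 0 then 1 else if w = 8 then 444 else if w = 9 then 496 else if w = 10 then 2160 else if w = 11 then 4752 else if w = 12 then 8760 else if w = 13 then 17856 else if w = 14 then 28992 else if w = 15 then 44352 else if w = 16 then 54318 else if w = 17 then 62496 else if w = 18 then 72864 else if w = 19 then 66528 else if w = 20 then 54192 else if w = 21 then 41664 else if w = 22 then 28992 else if w = 23 then 19008 else if w = 24 then 8844 else if w = 25 then 4464 else if w = 26 then 2160 else if w = 27 then 528 else if w = 28 then 408 else if w = 32 then 9 else 0 := by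
  have h := congrArg (fun p => p.coeff w) (sum_messages_pow_wt (X : ℤ[X]))
  simp only [coeff_sum_X_pow, ← ncard_wt_eq hω, weightEnumerator] at h
  rw [← Nat.cast_inj (R := ℤ), h]
  rcases le_or_gt w 32 with hw | hw
  · interval_cases w <;> simp [coeff_one, coeff_X_pow, coeff_ofNat_mul]
  · simp (disch := omega) only [coeff_add, coeff_one, coeff_ofNat_mul, coeff_X_pow, if_neg]
    simp
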